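/- Let a, b > 0 and let f(r) = a r^{-12} - b r^{-6}. Set V_{A₂} = (2 a ζ_{A₂}(12) / (b ζ_{A₂}(6)))^{1/3}. Then for every two-dimensional lattice L, E_f[L] ≥ E_f[√(V_{A₂})·A₂], and equality holds if and only if L = O·(√(V_{A₂})·A₂) for some orthogonal transformation O of ℝ². In other words, the triangular lattice of co-volume V_{A₂} is the unique global minimizer of E_f among all two-dimensional lattices, up to rotation. -/

import Mathlib

open scoped Pointwise

noncomputable section

/-- A point of the Euclidean plane with coordinates `a`, `b`. -/
def vec2 (a b : ℝ) : EuclideanSpace ℝ (Fin 2) := (WithLp.equiv 2 (Fin 2 → ℝ)).symm ![a, b]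

/-- The lattice (as a set of points) generated by `u` and `v`. -/
def latticeSet (u v : EuclideanSpace ℝ (Fin 2)) : Set (EuclideanSpace ℝ (Fin 2)) :=
  {p | ∃ m n : ℤ, p = (m : ℝ) • u + (n : ℝ) • v}

/-- The determinant of the pair of plane vectors `(u, v)`. -/
def det2 (u v : EuclideanSpace ℝ (Fin 2)) : ℝ := u 0 * v 1 - u 1 * v 0

/-- `L` is a two-dimensional lattice, i.e. `L = ℤu ⊕ ℤv` for a basis `(u,v)` of ℝ². -/
def IsLattice2 (L : Set (EuclideanSpace ℝ (Fin 2))) : Prop :=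
  ∃ u v : EuclideanSpace ℝ (Fin 2), det2 u v ≠ 0 ∧ L = latticeSet u v

/-- `L` is a two-dimensional lattice of co-volume `V = |det(u,v)|`. -/
def IsLattice2OfCovol (L : Set (EuclideanSpace ℝ (Fin 2))) (V : ℝ) : Prop :=
  ∃ u v : EuclideanSpace ℝ (Fin 2), det2 u v ≠ 0 ∧ |det2 u v| = V ∧ L = latticeSet u v

/-- The Epstein zeta function of a set of points: `ζ_L(s) = Σ'_{p ∈ L, p ≠ 0} |p|^{-s}`. -/
def epsteinZeta (L : Set (EuclideanSpace ℝ (Fin 2))) (s : ℝ) : ℝ :=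
  ∑' p : ↥(L \ {0}), ‖(p : EuclideanSpace ℝ (Fin 2))‖ ^ (-s)

/-- The Lennard-Jones type energy `E_f[L] = Σ'_{p ∈ L, p ≠ 0} (a|p|^{-α} - b|p|^{-β})`. -/
def LJenergy (a b α β : ℝ) (L : Set (EuclideanSpace ℝ (Fin 2))) : ℝ :=
  ∑' p : ↥(L \ {0}),
    (a * ‖(p : EuclideanSpace ℝ (Fin 2))‖ ^ (-α) - b * ‖(p : EuclideanSpace ℝ (Fin 2))‖ ^ (-β))

/-- The triangular lattice `A₂ = √(2/√3)·[ℤ(1,0) ⊕ ℤ(1/2,√3/2)]`, of co-volume 1. -/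
def triangularLattice : Set (EuclideanSpace ℝ (Fin 2)) :=
  latticeSet (Real.sqrt (2 / Real.sqrt 3) • vec2 1 0)
    (Real.sqrt (2 / Real.sqrt 3) • vec2 (1 / 2) (Real.sqrt 3 / 2))

/-- The square lattice `ℤ² = ℤ(1,0) ⊕ ℤ(0,1)`. -/
def squareLattice : Set (EuclideanSpace ℝ (Fin 2)) := latticeSet (vec2 1 0) (vec2 0 1)

/-- `L` is the image of `L'` under an orthogonal transformation of ℝ². -/
def IsRotationOf (L L' : Set (EuclideanSpace ℝ (Fin 2))) : Prop :=
  ∃ O : EuclideanSpace ℝ (Fin 2) ≃ₗᵢ[ℝ] EuclideanSpace ℝ (Fin 2), L = O '' L'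

/-- The unit co-volume lattice parametrized by `(x, y)` in the half-fundamental domain:
`ℤu ⊕ ℤv` with `u = (1/√y, 0)` and `v = (x/√y, √y)`. -/
def latticeXY (x y : ℝ) : Set (EuclideanSpace ℝ (Fin 2)) :=
  latticeSet (vec2 (1 / Real.sqrt y) 0) (vec2 (x / Real.sqrt y) (Real.sqrt y))

/-- The Riemann zeta function `ζ(s) = Σ_{m ≥ 1} m^{-s}` (real variable version). -/
def riemannZetaReal (s : ℝ) : ℝ := ∑' n : ℕ+, (n : ℝ) ^ (-s)

end

theorem inv_cube_tangent {s t : ℝ} (hs : 0 < s) (ht : 0 < t) :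
    (t ^ 3)⁻¹ = (s ^ 3)⁻¹ - 3 * (s ^ 4)⁻¹ * (t - s) +
      (t - s) ^ 2 * (3 * (s ^ 4)⁻¹ * t⁻¹ + 2 * (s ^ 3)⁻¹ * (t ^ 2)⁻¹ +
        (s ^ 2)⁻¹ * (t ^ 3)⁻¹) := by
  field_simp
  ring

theorem inv_cube_ge_tangent {s t : ℝ} (hs : 0 < s) (ht : 0 < t) :
    (s ^ 3)⁻¹ - 3 * (s ^ 4)⁻¹ * (t - s) ≤ (t ^ 3)⁻¹ := by
  rw [inv_cube_tangent hs ht]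
  have : 0 ≤ (t - s) ^ 2 * (3 * (s ^ 4)⁻¹ * t⁻¹ + 2 * (s ^ 3)⁻¹ * (t ^ 2)⁻¹ +
        (s ^ 2)⁻¹ * (t ^ 3)⁻¹) := by positivity
  linarith

theorem inv_cube_le_tangent {s t : ℝ} (hs : 0 < s) (ht : 2 / 3 ≤ t) :
    (t ^ 3)⁻¹ ≤ (s ^ 3)⁻¹ - 3 * (s ^ 4)⁻¹ * (t - s) +
      (t - s) ^ 2 * (9 / 2 * (s ^ 4)⁻¹ + 9 / 2 * (s ^ 3)⁻¹ + 27 / 8 * (s ^ 2)⁻¹) := by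
  have h0 : 0 < t := by linarith
  rw [inv_cube_tangent hs h0]
  have h1 : t⁻¹ ≤ 3 / 2 := by
    rw [inv_le_comm₀ h0 (by norm_num)]; linarith
  have h2 : (t ^ 2)⁻¹ ≤ 9 / 4 := by
    rw [← inv_pow]
    calc t⁻¹ ^ 2 ≤ (3 / 2) ^ 2 := by gcongr
      _ = 9 / 4 := by norm_num
  have h3 : (t ^ 3)⁻¹ ≤ 27 / 8 := by
    rw [← inv_pow]
    calc t⁻¹ ^ 3 ≤ (3 / 2) ^ 3 := by gcongr
      _ = 27 / 8 := by norm_num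
  gcongr (s ^ 3)⁻¹ - 3 * (s ^ 4)⁻¹ * (t - s) + (t - s) ^ 2 * ?_
  have e1 := mul_le_mul_of_nonneg_left h1 (by positivity : 0 ≤ 3 * (s ^ 4)⁻¹)
  have e2 := mul_le_mul_of_nonneg_left h2 (by positivity : 0 ≤ 2 * (s ^ 3)⁻¹)
  have e3 := mul_le_mul_of_nonneg_left h3 (by positivity : 0 ≤ (s ^ 2)⁻¹)
  linarith

theorem sum_inv_cube_ge {s t₁ t₂ t₃ : ℝ} (h₁ : 0 < t₁) (h₂ : 0 < t₂) (h₃ : 0 < t₃)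
    (hsum : t₁ + t₂ + t₃ = 3 * s) :
    3 * (s ^ 3)⁻¹ ≤ (t₁ ^ 3)⁻¹ + (t₂ ^ 3)⁻¹ + (t₃ ^ 3)⁻¹ := by
  have hs : 0 < s := by linarith
  have e : 3 * (s ^ 4)⁻¹ * (t₁ - s) + 3 * (s ^ 4)⁻¹ * (t₂ - s) + 3 * (s ^ 4)⁻¹ * (t₃ - s) = 0 := by
    linear_combination 3 * (s ^ 4)⁻¹ * hsum
  linarith [inv_cube_ge_tangent hs h₁, inv_cube_ge_tangent hs h₂, inv_cube_ge_tangent hs h₃]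

theorem sum_inv_cube_le {s t₁ t₂ t₃ : ℝ} (h₁ : 2 / 3 ≤ t₁) (h₂ : 2 / 3 ≤ t₂) (h₃ : 2 / 3 ≤ t₃)
    (hsum : t₁ + t₂ + t₃ = 3 * s) :
    (t₁ ^ 3)⁻¹ + (t₂ ^ 3)⁻¹ + (t₃ ^ 3)⁻¹ ≤ 3 * (s ^ 3)⁻¹ +
      ((t₁ - s) ^ 2 + (t₂ - s) ^ 2 + (t₃ - s) ^ 2) *
        (9 / 2 * (s ^ 4)⁻¹ + 9 / 2 * (s ^ 3)⁻¹ + 27 / 8 * (s ^ 2)⁻¹) := by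
  have hs : 0 < s := by linarith
  have e : 3 * (s ^ 4)⁻¹ * (t₁ - s) + 3 * (s ^ 4)⁻¹ * (t₂ - s) + 3 * (s ^ 4)⁻¹ * (t₃ - s) = 0 := by
    linear_combination 3 * (s ^ 4)⁻¹ * hsum
  linarith [inv_cube_le_tangent hs h₁, inv_cube_le_tangent hs h₂, inv_cube_le_tangent hs h₃]

/-- A bound on the remainder terms of the tangent estimate for forms far from the hexagonal one. -/
theorem remainder_far {C : ℝ} (hC : 2 ≤ C) :
    (243 / 16 * (C ^ 4)⁻¹ + 81 / 8 * (C ^ 3)⁻¹ + 81 / 16 * (C ^ 2)⁻¹) *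
      (1 + ((C - 1) ^ 3)⁻¹ + (C ^ 3)⁻¹) ≤ 387 / 40 * ((C ^ 2 + C + 1) / C ^ 3) ^ 2 := by
  obtain ⟨d, hd, rfl⟩ : ∃ d, 0 ≤ d ∧ C = 2 + d := ⟨C - 2, by linarith, by ring⟩
  have e : (2 + d - 1) = 1 + d := by ring
  rw [e, ← sub_nonneg]
  have h : 0 < 2 + d := by linarith
  have h' : 0 < 1 + d := by linarith
  field_simp
  ring_nf
  positivity

theorem remainder_near {C : ℝ} (hC : 1 ≤ C) (hC' : C ≤ 2) :
    (243 * ((C + 2) ^ 4)⁻¹ + 81 * ((C + 2) ^ 3)⁻¹ + 81 / 4 * ((C + 2) ^ 2)⁻¹) *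
      (2 + (C ^ 3)⁻¹) ≤ 387 / 40 * ((C ^ 2 + C + 1) / C ^ 3) ^ 2 := by
  obtain ⟨d, hd, rfl⟩ : ∃ d, 0 ≤ d ∧ C = 2 - d := ⟨2 - C, by linarith, by ring⟩
  have hd1 : d ≤ 1 := by linarith
  rw [← sub_nonneg]
  have h : 0 < 2 - d := by linarith
  have h' : 0 < 4 - d := by linarith
  have e : (2 - d + 2) = 4 - d := by ring
  rw [e]
  have : 387 / 40 * (((2 - d) ^ 2 + (2 - d) + 1) / (2 - d) ^ 3) ^ 2 -
      (243 * ((4 - d) ^ 4)⁻¹ + 81 * ((4 - d) ^ 3)⁻¹ + 81 / 4 * ((4 - d) ^ 2)⁻¹) *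
      (2 + ((2 - d) ^ 3)⁻¹) =
      (387 / 40 * ((2 - d) ^ 2 + (2 - d) + 1) ^ 2 * (4 - d) ^ 4 -
        (243 + 81 * (4 - d) + 81 / 4 * (4 - d) ^ 2) * (2 * (2 - d) ^ 6 + (2 - d) ^ 3)) /
      ((2 - d) ^ 6 * (4 - d) ^ 4) := by
    field_simp
  rw [this]
  apply div_nonneg _ (by positivity)
  have h1 : 0 ≤ 1 - d := by linarith
  calc 0 ≤ 936 / 5 * (1 - d) ^ 8 + 463212 / 5 * d * (1 - d) ^ 7 +
      2133648 / 5 * d ^ 2 * (1 - d) ^ 6 + 843534 * d ^ 3 * (1 - d) ^ 5 +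
      37044783 / 40 * d ^ 4 * (1 - d) ^ 4 + 1220589 / 2 * d ^ 5 * (1 - d) ^ 3 +
      9664839 / 40 * d ^ 6 * (1 - d) ^ 2 + 266328 / 5 * d ^ 7 * (1 - d) +
      201933 / 40 * d ^ 8 := by
        positivity
    _ = _ := by ring

/-- The deviation of a reduced form from the hexagonal one is controlled by the spread of the
inverse cubes of its three minimal values. -/
theorem remainder_mul_le {B C s : ℝ} (hB : 1 ≤ B) (hBC : B ≤ C) (hC : C ≤ 1 + B)
    (hs : 1 + B + C = 3 * s) :
    ((1 - s) ^ 2 + (B - s) ^ 2 + (C - s) ^ 2) *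
        (9 / 2 * (s ^ 4)⁻¹ + 9 / 2 * (s ^ 3)⁻¹ + 27 / 8 * (s ^ 2)⁻¹) *
        (1 + (B ^ 3)⁻¹ + (C ^ 3)⁻¹) ≤
      129 / 20 * (3 * (1 + ((B ^ 3)⁻¹) ^ 2 + ((C ^ 3)⁻¹) ^ 2) -
        (1 + (B ^ 3)⁻¹ + (C ^ 3)⁻¹) ^ 2) := by
  have hC0 : 0 < C := by linarith
  have hB0 : 0 < B := by linarith
  have hs0 : 0 < s := by linarith
  have hdev : (1 - s) ^ 2 + (B - s) ^ 2 + (C - s) ^ 2 ≤ 2 / 3 * (C - 1) ^ 2 := by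
    obtain rfl : s = (1 + B + C) / 3 := by linarith
    nlinarith [mul_nonneg (sub_nonneg.2 hB) (sub_nonneg.2 hBC)]
  have hspread : 3 / 2 * (1 - (C ^ 3)⁻¹) ^ 2 ≤ 3 * (1 + ((B ^ 3)⁻¹) ^ 2 + ((C ^ 3)⁻¹) ^ 2) -
        (1 + (B ^ 3)⁻¹ + (C ^ 3)⁻¹) ^ 2 := by
    nlinarith [sq_nonneg ((B ^ 3)⁻¹ - 1 / 2 * (1 + (C ^ 3)⁻¹))]
  have hz : 1 - (C ^ 3)⁻¹ = (C - 1) * ((C ^ 2 + C + 1) / C ^ 3) := by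
    field_simp
    ring
  have key : (3 * (s ^ 4)⁻¹ + 3 * (s ^ 3)⁻¹ + 9 / 4 * (s ^ 2)⁻¹) *
      (1 + (B ^ 3)⁻¹ + (C ^ 3)⁻¹) ≤ 387 / 40 * ((C ^ 2 + C + 1) / C ^ 3) ^ 2 := by
    rcases le_total C 2 with h2 | h2
    · have h3 : (C + 2) / 3 ≤ s := by linarith
      have hy : (B ^ 3)⁻¹ ≤ 1 := inv_le_one_of_one_le₀ (one_le_pow₀ hB)
      refine le_trans ?_ (remainder_near (hB.trans hBC) h2)
      calc _ ≤ (3 * (((C + 2) / 3) ^ 4)⁻¹ + 3 * (((C + 2) / 3) ^ 3)⁻¹ +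
            9 / 4 * (((C + 2) / 3) ^ 2)⁻¹) * (1 + 1 + (C ^ 3)⁻¹) := by gcongr
        _ = _ := by field_simp; ring
    · have h3 : 2 * C / 3 ≤ s := by linarith
      have h4 : 0 < C - 1 := by linarith
      have h5 : C - 1 ≤ B := by linarith
      refine le_trans ?_ (remainder_far h2)
      calc _ ≤ (3 * ((2 * C / 3) ^ 4)⁻¹ + 3 * ((2 * C / 3) ^ 3)⁻¹ +
            9 / 4 * ((2 * C / 3) ^ 2)⁻¹) * (1 + ((C - 1) ^ 3)⁻¹ + (C ^ 3)⁻¹) := by gcongr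
        _ = _ := by field_simp; ring
  calc _ ≤ 2 / 3 * (C - 1) ^ 2 * (9 / 2 * (s ^ 4)⁻¹ + 9 / 2 * (s ^ 3)⁻¹ + 27 / 8 * (s ^ 2)⁻¹) *
        (1 + (B ^ 3)⁻¹ + (C ^ 3)⁻¹) := by gcongr
    _ = (C - 1) ^ 2 * ((3 * (s ^ 4)⁻¹ + 3 * (s ^ 3)⁻¹ + 9 / 4 * (s ^ 2)⁻¹) *
        (1 + (B ^ 3)⁻¹ + (C ^ 3)⁻¹)) := by ring
    _ ≤ (C - 1) ^ 2 * (387 / 40 * ((C ^ 2 + C + 1) / C ^ 3) ^ 2) := by gcongr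
    _ = 129 / 20 * (3 / 2 * (1 - (C ^ 3)⁻¹) ^ 2) := by rw [hz]; ring
    _ ≤ _ := by gcongr

/-- For a reduced triple `(1, B, C)` and a triple `t` with the same first two power sums. -/
theorem sum_inv_cube_mul_le {B C t₁ t₂ t₃ : ℝ} (hB : 1 ≤ B) (hBC : B ≤ C) (hC : C ≤ 1 + B)
    (h₁ : 2 / 3 ≤ t₁) (h₂ : 2 / 3 ≤ t₂) (h₃ : 2 / 3 ≤ t₃) (hsum : t₁ + t₂ + t₃ = 1 + B + C)
    (hsq : t₁ ^ 2 + t₂ ^ 2 + t₃ ^ 2 = 1 + B ^ 2 + C ^ 2) :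
    ((t₁ ^ 3)⁻¹ + (t₂ ^ 3)⁻¹ + (t₃ ^ 3)⁻¹) * (1 + (B ^ 3)⁻¹ + (C ^ 3)⁻¹) ≤
      (1 + (B ^ 3)⁻¹ + (C ^ 3)⁻¹) ^ 2 +
      129 / 20 * (3 * (1 + ((B ^ 3)⁻¹) ^ 2 + ((C ^ 3)⁻¹) ^ 2) -
        (1 + (B ^ 3)⁻¹ + (C ^ 3)⁻¹) ^ 2) := by
  obtain ⟨s, hs⟩ : ∃ s, 1 + B + C = 3 * s := ⟨(1 + B + C) / 3, by ring⟩
  have hC0 : 0 < C := by linarith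
  have hB0 : 0 < B := by linarith
  have hle := sum_inv_cube_le h₁ h₂ h₃ (hsum.trans hs)
  have hge := sum_inv_cube_ge one_pos hB0 hC0 hs
  have hdev : (t₁ - s) ^ 2 + (t₂ - s) ^ 2 + (t₃ - s) ^ 2 =
      (1 - s) ^ 2 + (B - s) ^ 2 + (C - s) ^ 2 := by
    linear_combination hsq - 2 * s * hsum
  rw [hdev] at hle
  rw [one_pow, inv_one] at hge
  have hmul := mul_le_mul_of_nonneg_right (hle.trans (add_le_add_left hge _))
    (by positivity : 0 ≤ 1 + (B ^ 3)⁻¹ + (C ^ 3)⁻¹)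
  linarith [remainder_mul_le hB hBC hC hs]

theorem sum_inv_pow_six_ge {B C t₁ t₂ t₃ : ℝ} (hB : 1 ≤ B) (hBC : B ≤ C) (hC : C ≤ 1 + B)
    (h₁ : 0 < t₁) (h₂ : 0 < t₂) (h₃ : 0 < t₃) (hsum : t₁ + t₂ + t₃ = 1 + B + C) :
    1 + ((B ^ 3)⁻¹) ^ 2 + ((C ^ 3)⁻¹) ^ 2 -
      139 / 30 * (3 * (1 + ((B ^ 3)⁻¹) ^ 2 + ((C ^ 3)⁻¹) ^ 2) -
        (1 + (B ^ 3)⁻¹ + (C ^ 3)⁻¹) ^ 2) ≤ (t₁ ^ 6)⁻¹ + (t₂ ^ 6)⁻¹ + (t₃ ^ 6)⁻¹ := by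
  obtain ⟨s, hs⟩ : ∃ s, 1 + B + C = 3 * s := ⟨(1 + B + C) / 3, by ring⟩
  have hge := sum_inv_cube_ge h₁ h₂ h₃ (hsum.trans hs)
  have hle := sum_inv_cube_le (by norm_num) (by linarith) (by linarith) hs
  have hrem := remainder_mul_le hB hBC hC hs
  have hs0 : 0 < s := by linarith
  have hx : 0 < (s ^ 3)⁻¹ := by positivity
  have e : ∀ t : ℝ, (t ^ 6)⁻¹ = ((t ^ 3)⁻¹) ^ 2 := fun t => by rw [inv_pow, ← pow_mul]
  rw [e, e, e]
  rw [one_pow, inv_one] at hle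
  have hy : 0 < (B ^ 3)⁻¹ := by positivity
  have hz : 0 < (C ^ 3)⁻¹ := by have : 0 < C := by linarith
                                positivity
  generalize (B ^ 3)⁻¹ = y at *
  generalize (C ^ 3)⁻¹ = z at *
  generalize (s ^ 3)⁻¹ = x at *
  generalize (t₁ ^ 3)⁻¹ = r₁ at *
  generalize (t₂ ^ 3)⁻¹ = r₂ at *
  generalize (t₃ ^ 3)⁻¹ = r₃ at *
  have h3 : 3 * x ^ 2 ≤ r₁ ^ 2 + r₂ ^ 2 + r₃ ^ 2 := by
    nlinarith [sq_nonneg (r₁ - x), sq_nonneg (r₂ - x), sq_nonneg (r₃ - x)]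
  have hmul := mul_le_mul_of_nonneg_right hle (by positivity : 0 ≤ 1 + y + z)
  nlinarith [sq_nonneg (x - (1 + y + z) / 3)]

/-- The quadratic form with values `A`, `B`, `C` at `(1, 0)`, `(0, 1)` and `(1, -1)`. -/
def ternaryForm (A B C : ℝ) (p : ℤ × ℤ) : ℝ :=
  p.1 * (p.1 + p.2) * A + p.2 * (p.1 + p.2) * B - p.1 * p.2 * C

/-- The rotation of order three permuting the values of `ternaryForm` cyclically. -/
def hexRotation : ℤ × ℤ ≃ ℤ × ℤ where
  toFun p := (p.2, -p.1 - p.2)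
  invFun p := (-p.1 - p.2, p.1)
  left_inv p := Prod.ext (by dsimp only; ring) rfl
  right_inv p := Prod.ext rfl (by dsimp only; ring)

theorem ternaryForm_hexRotation (A B C : ℝ) (p : ℤ × ℤ) :
    ternaryForm A B C (hexRotation p) = ternaryForm B C A p := by
  simp only [ternaryForm, hexRotation, Equiv.coe_fn_mk]
  push_cast
  ring

theorem ternaryForm_smul (r A B C : ℝ) (p : ℤ × ℤ) :
    ternaryForm (r * A) (r * B) (r * C) p = r * ternaryForm A B C p := by
  simp only [ternaryForm]
  ring

theorem ternaryForm_zero (A B C : ℝ) : ternaryForm A B C 0 = 0 := by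
  simp [ternaryForm]

theorem ternaryForm_hex_ge (p : ℤ × ℤ) :
    1 / 2 * ((p.1 : ℝ) ^ 2 + (p.2 : ℝ) ^ 2) ≤ ternaryForm 1 1 1 p := by
  simp only [ternaryForm]
  nlinarith [sq_nonneg ((p.1 : ℝ) + p.2)]

theorem sq_add_sq_pos {p : ℤ × ℤ} (hp : p ≠ 0) : 1 ≤ (p.1 : ℝ) ^ 2 + (p.2 : ℝ) ^ 2 := by
  have h : 0 < p.1 ^ 2 + p.2 ^ 2 := by
    by_contra! h
    apply hp
    have h1 : p.1 = 0 := by nlinarith [sq_nonneg p.1, sq_nonneg p.2]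
    have h2 : p.2 = 0 := by nlinarith [sq_nonneg p.1, sq_nonneg p.2]
    exact Prod.ext h1 h2
  exact_mod_cast h

theorem ternaryForm_hex_pos {p : ℤ × ℤ} (hp : p ≠ 0) : 0 < ternaryForm 1 1 1 p := by
  linarith [ternaryForm_hex_ge p, sq_add_sq_pos hp]

theorem ternaryForm_ge_hex {B C : ℝ} (hB : 1 ≤ B) (hBC : B ≤ C) (hC : C ≤ 1 + B) (p : ℤ × ℤ) :
    2 / 3 * ternaryForm 1 1 1 p ≤ ternaryForm 1 B C p := by
  simp only [ternaryForm]
  generalize (p.1 : ℝ) = m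
  generalize (p.2 : ℝ) = n
  have h : 0 ≤ (1 / 3 * m + (1 / 6 + (B - C) / 2) * n) ^ 2 := sq_nonneg _
  have h2 : 0 ≤ (1 / 3 * (B - 2 / 3) - (1 / 6 + (B - C) / 2) ^ 2) * n ^ 2 := by
    refine mul_nonneg ?_ (sq_nonneg n)
    nlinarith
  nlinarith

theorem summable_inv_sq_add_sq_pow {k : ℕ} (hk : 2 ≤ k) :
    Summable fun p : ℤ × ℤ => (((p.1 : ℝ) ^ 2 + (p.2 : ℝ) ^ 2) ^ k)⁻¹ := by
  have h := (EisensteinSeries.summable_one_div_norm_rpow (k := 4) (by norm_num))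
  rw [← (finTwoArrowEquiv ℤ).symm.summable_iff] at h
  refine h.of_nonneg_of_le (fun p => by positivity) fun p => ?_
  rcases eq_or_ne p 0 with rfl | hp
  · have : k ≠ 0 := by omega
    simp [this]
  have h1 := sq_add_sq_pos hp
  have hx : ‖(finTwoArrowEquiv ℤ).symm p‖ ^ 2 ≤ (p.1 : ℝ) ^ 2 + (p.2 : ℝ) ^ 2 := by
    have : ‖(finTwoArrowEquiv ℤ).symm p‖ ≤ Real.sqrt ((p.1 : ℝ) ^ 2 + (p.2 : ℝ) ^ 2) := by
      rw [pi_norm_le_iff_of_nonneg (Real.sqrt_nonneg _)]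
      intro i
      apply Real.le_sqrt_of_sq_le
      fin_cases i <;> simp [Int.norm_eq_abs] <;> positivity
    calc _ ≤ Real.sqrt ((p.1 : ℝ) ^ 2 + (p.2 : ℝ) ^ 2) ^ 2 := by gcongr
      _ = _ := Real.sq_sqrt (by positivity)
  have hpos : 0 < ‖(finTwoArrowEquiv ℤ).symm p‖ := by
    rw [norm_pos_iff]
    intro h0
    apply hp
    have := congrArg (finTwoArrowEquiv ℤ) h0
    exact this.trans rfl
  simp only [Function.comp]
  rw [Real.rpow_neg hpos.le]
  apply inv_anti₀ (by positivity)
  calc ‖(finTwoArrowEquiv ℤ).symm p‖ ^ (4 : ℝ) = (‖(finTwoArrowEquiv ℤ).symm p‖ ^ 2) ^ 2 := by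
        rw [← pow_mul]; exact_mod_cast Real.rpow_natCast _ 4
    _ ≤ ((p.1 : ℝ) ^ 2 + (p.2 : ℝ) ^ 2) ^ 2 := by gcongr
    _ ≤ _ := pow_le_pow_right₀ h1 hk

theorem summable_inv_pow_of_ge {q : ℤ × ℤ → ℝ} {c : ℝ} (hc : 0 < c) (h0 : q 0 = 0)
    (hq : ∀ p : ℤ × ℤ, c * ((p.1 : ℝ) ^ 2 + (p.2 : ℝ) ^ 2) ≤ q p) {k : ℕ} (hk : 2 ≤ k) :
    Summable fun p => (q p ^ k)⁻¹ := by
  have hq0 : ∀ p, 0 ≤ q p := fun p => le_trans (by positivity) (hq p)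
  refine ((summable_inv_sq_add_sq_pow hk).mul_left (c ^ k)⁻¹).of_nonneg_of_le
    (fun p => inv_nonneg.2 (pow_nonneg (hq0 p) k)) fun p => ?_
  rcases eq_or_ne p 0 with rfl | hp
  · have : k ≠ 0 := by omega
    simp [h0, this]
  have h1 := sq_add_sq_pos hp
  rw [← mul_inv, ← mul_pow]
  have := hq p
  apply inv_anti₀ (by positivity)
  gcongr

theorem summable_ternaryForm_hex {k : ℕ} (hk : 2 ≤ k) :
    Summable fun p : ℤ × ℤ => (ternaryForm 1 1 1 p ^ k)⁻¹ :=
  summable_inv_pow_of_ge (by norm_num : (0 : ℝ) < 1 / 2) (ternaryForm_zero _ _ _)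
    ternaryForm_hex_ge hk

/-- The Epstein zeta value `∑ q(p)⁻ᵏ` of the form `ternaryForm A B C`. -/
noncomputable def formZeta (k : ℕ) (A B C : ℝ) : ℝ := ∑' p : ℤ × ℤ, (ternaryForm A B C p ^ k)⁻¹

theorem formZeta_smul (k : ℕ) (r A B C : ℝ) :
    formZeta k (r * A) (r * B) (r * C) = (r ^ k)⁻¹ * formZeta k A B C := by
  simp only [formZeta, ternaryForm_smul, mul_pow, mul_inv, tsum_mul_left]

theorem six_le_formZeta_hex {k : ℕ} (hk : 2 ≤ k) : 6 ≤ formZeta k 1 1 1 := by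
  have h := (summable_ternaryForm_hex hk).sum_le_tsum
    {(1, 0), (-1, 0), (0, 1), (0, -1), (1, -1), (-1, 1)} fun p _ => by
      have := ternaryForm_hex_ge p
      have : 0 ≤ ternaryForm 1 1 1 p := le_trans (by positivity) this
      positivity
  refine le_trans (le_of_eq ?_) h
  rw [Finset.sum_insert (by decide), Finset.sum_insert (by decide), Finset.sum_insert (by decide),
    Finset.sum_insert (by decide), Finset.sum_insert (by decide), Finset.sum_singleton]
  norm_num [ternaryForm]

/-- Summing over all pairs is the same as summing the average over `hexRotation`. -/
theorem three_mul_tsum {f : ℤ × ℤ → ℝ} (hf : Summable f) :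
    3 * ∑' p, f p =
      ∑' p, (f p + f (hexRotation p) + f (hexRotation (hexRotation p))) ∧
    Summable fun p => f p + f (hexRotation p) + f (hexRotation (hexRotation p)) := by
  have h1 : Summable fun p => f (hexRotation p) := hexRotation.summable_iff.2 hf
  have h2 : Summable fun p => f (hexRotation (hexRotation p)) := hexRotation.summable_iff.2 h1
  refine ⟨?_, (hf.add h1).add h2⟩
  rw [(hf.add h1).tsum_add h2, hf.tsum_add h1,
    hexRotation.tsum_eq (fun p => f (hexRotation p)), hexRotation.tsum_eq f]
  ring

/-- Indicator function of the sector `0 < m * n`. -/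
def sector (p : ℤ × ℤ) : ℝ := if 0 < p.1 * p.2 then 1 else 0

/-- The multiplicity with which the three rotates of the open sector `0 < m * n` cover `p`. -/
def offAxis (p : ℤ × ℤ) : ℝ :=
  sector p + sector (hexRotation p) + sector (hexRotation (hexRotation p))

theorem sector_nonneg (p : ℤ × ℤ) : 0 ≤ sector p := by
  unfold sector
  split_ifs <;> norm_num

theorem offAxis_nonneg (p : ℤ × ℤ) : 0 ≤ offAxis p :=
  add_nonneg (add_nonneg (sector_nonneg _) (sector_nonneg _)) (sector_nonneg _)

theorem one_le_offAxis {p : ℤ × ℤ} (h : p.1 * p.2 * (p.1 + p.2) ≠ 0) : 1 ≤ offAxis p := by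
  obtain ⟨m, n⟩ := p
  have h0 : 0 < m * n ∨ 0 < n * (-m - n) ∨ 0 < (-m - n) * m := by
    by_contra! hh
    obtain ⟨h1, h2, h3⟩ := hh
    have h4 := mul_nonneg (neg_nonneg.2 h1) (mul_nonneg (neg_nonneg.2 h2) (neg_nonneg.2 h3))
    have h5 : 0 < (m * n * (m + n)) ^ 2 := by positivity
    nlinarith
  have a1 := sector_nonneg (m, n)
  have a2 := sector_nonneg (n, -m - n)
  have a3 := sector_nonneg (-m - n, -n - (-m - n))
  have e : -n - (-m - n) = m := by ring
  have key : offAxis (m, n) = sector (m, n) + sector (n, -m - n) + sector (-m - n, m) := by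
    simp only [offAxis, hexRotation, Equiv.coe_fn_mk, e]
  rw [e] at a3
  rw [key]
  rcases h0 with h0 | h0 | h0
  · have : sector (m, n) = 1 := if_pos h0
    linarith
  · have : sector (n, -m - n) = 1 := if_pos h0
    linarith
  · have : sector (-m - n, m) = 1 := if_pos h0
    linarith

theorem sum_range_inv_cube_le (n : ℕ) :
    ∑ i ∈ Finset.range n, (((i : ℝ) + 1) ^ 3)⁻¹ ≤ 29 / 24 := by
  have key : ∀ n : ℕ, ∑ i ∈ Finset.range (n + 2), (((i : ℝ) + 1) ^ 3)⁻¹ ≤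
      29 / 24 - 1 / (2 * ((n : ℝ) + 2) * ((n : ℝ) + 3)) := by
    intro n
    induction n with
    | zero => norm_num [Finset.sum_range_succ]
    | succ n ih =>
      rw [Finset.sum_range_succ]
      have : (((((n + 2 : ℕ) : ℝ)) + 1) ^ 3)⁻¹ ≤
          1 / (2 * ((n : ℝ) + 2) * (n + 3)) - 1 / (2 * ((n : ℝ) + 3) * (n + 4)) := by
        push_cast
        rw [← sub_nonneg]
        have : 1 / (2 * ((n : ℝ) + 2) * (n + 3)) - 1 / (2 * ((n : ℝ) + 3) * (n + 4)) -
            (((n : ℝ) + 2 + 1) ^ 3)⁻¹ = 1 / ((n + 2) * (n + 3) ^ 3 * (n + 4)) := by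
          field_simp
          ring
        rw [this]
        positivity
      have e : (1 : ℝ) / (2 * (((n + 1 : ℕ) : ℝ) + 2) * (((n + 1 : ℕ) : ℝ) + 3)) =
          1 / (2 * ((n : ℝ) + 3) * (n + 4)) := by
        push_cast
        ring_nf
      rw [e]
      linarith
  calc _ ≤ ∑ i ∈ Finset.range (n + 2), (((i : ℝ) + 1) ^ 3)⁻¹ :=
        Finset.sum_le_sum_of_subset_of_nonneg (Finset.range_mono (by omega))
          fun i _ _ => by positivity
    _ ≤ 29 / 24 - 1 / (2 * ((n : ℝ) + 2) * ((n : ℝ) + 3)) := key n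
    _ ≤ 29 / 24 := by
      have : (0 : ℝ) ≤ 1 / (2 * ((n : ℝ) + 2) * ((n : ℝ) + 3)) := by positivity
      linarith

/-- The inverse cubes of the positive integers, extended by zero to all integers. -/
noncomputable def posInvCube (m : ℤ) : ℝ := if 0 < m then ((m : ℝ) ^ 3)⁻¹ else 0

theorem posInvCube_nonneg (m : ℤ) : 0 ≤ posInvCube m := by
  unfold posInvCube
  split_ifs <;> positivity

theorem hasSum_posInvCube : ∃ Z : ℝ, HasSum posInvCube Z ∧ 0 ≤ Z ∧ Z ≤ 29 / 24 := by
  have hinj : Function.Injective fun n : ℕ => (n : ℤ) + 1 := fun a b h => by simpa using h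
  have hcomp : (posInvCube ∘ fun n : ℕ => (n : ℤ) + 1) = fun n : ℕ => (((n : ℝ) + 1) ^ 3)⁻¹ := by
    funext n
    have : 0 < (n : ℤ) + 1 := by positivity
    simp [posInvCube, this]
  have hs : Summable fun n : ℕ => (((n : ℝ) + 1) ^ 3)⁻¹ :=
    summable_of_sum_range_le (fun n => by positivity) sum_range_inv_cube_le
  refine ⟨∑' n : ℕ, (((n : ℝ) + 1) ^ 3)⁻¹, ?_, tsum_nonneg fun n => by positivity,
    Real.tsum_le_of_sum_range_le (fun n => by positivity) sum_range_inv_cube_le⟩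
  rw [← hinj.hasSum_iff, hcomp]
  · exact hs.hasSum
  · intro m hm
    refine if_neg fun h => hm ⟨(m - 1).toNat, ?_⟩
    simp only
    omega

theorem sector_mul_inv_cube_le (p : ℤ × ℤ) :
    sector p * (ternaryForm 1 1 1 p ^ 3)⁻¹ ≤
      1 / 27 * (posInvCube p.1 * posInvCube p.2 + posInvCube (-p.1) * posInvCube (-p.2)) := by
  obtain ⟨m, n⟩ := p
  have h1 := posInvCube_nonneg m
  have h2 := posInvCube_nonneg n
  have h3 := posInvCube_nonneg (-m)
  have h4 := posInvCube_nonneg (-n)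
  unfold sector
  split_ifs with h
  swap
  · rw [zero_mul]; positivity
  have hpos : (0 : ℝ) < m * n := by exact_mod_cast h
  have hK : 3 * ((m : ℝ) * n) ≤ ternaryForm 1 1 1 (m, n) := by
    simp only [ternaryForm]
    nlinarith [sq_nonneg ((m : ℝ) - n)]
  have hle : (ternaryForm 1 1 1 (m, n) ^ 3)⁻¹ ≤ 1 / 27 * (((m : ℝ) ^ 3)⁻¹ * ((n : ℝ) ^ 3)⁻¹) := by
    calc _ ≤ ((3 * ((m : ℝ) * n)) ^ 3)⁻¹ := by
          apply inv_anti₀ (by positivity)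
          gcongr
      _ = _ := by
        rw [mul_pow, mul_pow, mul_inv, mul_inv]; norm_num
  rw [one_mul]
  refine hle.trans ?_
  rcases pos_and_pos_or_neg_and_neg_of_mul_pos h with ⟨hm, hn⟩ | ⟨hm, hn⟩
  · have e1 : posInvCube m = ((m : ℝ) ^ 3)⁻¹ := if_pos hm
    have e2 : posInvCube n = ((n : ℝ) ^ 3)⁻¹ := if_pos hn
    simp only [e1, e2]
    have := mul_nonneg h3 h4
    linarith
  · have e1 : posInvCube (-m) = -((m : ℝ) ^ 3)⁻¹ := by
      rw [posInvCube, if_pos (by omega)]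
      push_cast
      rw [Odd.neg_pow (by decide), inv_neg]
    have e2 : posInvCube (-n) = -((n : ℝ) ^ 3)⁻¹ := by
      rw [posInvCube, if_pos (by omega)]
      push_cast
      rw [Odd.neg_pow (by decide), inv_neg]
    simp only [e1, e2]
    have := mul_nonneg h1 h2
    linarith

theorem sector_tsum_le :
    (Summable fun p => sector p * (ternaryForm 1 1 1 p ^ 3)⁻¹) ∧
      ∑' p, sector p * (ternaryForm 1 1 1 p ^ 3)⁻¹ ≤ 2 / 27 * (29 / 24) ^ 2 := by
  obtain ⟨Z, hZ, hZ0, hZ1⟩ := hasSum_posInvCube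
  have hprod : HasSum (fun p : ℤ × ℤ => posInvCube p.1 * posInvCube p.2) (Z * Z) :=
    hZ.mul hZ (hZ.summable.mul_of_nonneg hZ.summable posInvCube_nonneg posInvCube_nonneg)
  have hprodn := (Equiv.neg (ℤ × ℤ)).hasSum_iff.2 hprod
  simp only [Function.comp_def, Equiv.neg_apply, Prod.fst_neg, Prod.snd_neg] at hprodn
  have hsum := (hprod.add hprodn).mul_left (1 / 27)
  have h0 : ∀ p, 0 ≤ sector p * (ternaryForm 1 1 1 p ^ 3)⁻¹ := fun p => by
    have := sector_nonneg p
    have : 0 ≤ ternaryForm 1 1 1 p := le_trans (by positivity) (ternaryForm_hex_ge p)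
    positivity
  have hs := hsum.summable.of_nonneg_of_le h0 sector_mul_inv_cube_le
  refine ⟨hs, ?_⟩
  calc _ ≤ 1 / 27 * (Z * Z + Z * Z) := hasSum_le sector_mul_inv_cube_le hs.hasSum hsum
    _ ≤ 2 / 27 * (29 / 24) ^ 2 := by nlinarith

theorem offAxis_tsum_eq {k : ℕ} (hs : Summable fun p => sector p * (ternaryForm 1 1 1 p ^ k)⁻¹) :
    (Summable fun p => offAxis p * (ternaryForm 1 1 1 p ^ k)⁻¹) ∧
      ∑' p, offAxis p * (ternaryForm 1 1 1 p ^ k)⁻¹ =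
        3 * ∑' p, sector p * (ternaryForm 1 1 1 p ^ k)⁻¹ := by
  have h := three_mul_tsum hs
  have e : ∀ p, sector p * (ternaryForm 1 1 1 p ^ k)⁻¹ +
      sector (hexRotation p) * (ternaryForm 1 1 1 (hexRotation p) ^ k)⁻¹ +
      sector (hexRotation (hexRotation p)) *
        (ternaryForm 1 1 1 (hexRotation (hexRotation p)) ^ k)⁻¹ =
      offAxis p * (ternaryForm 1 1 1 p ^ k)⁻¹ := fun p => by
    simp only [ternaryForm_hexRotation, offAxis]
    ring
  simp only [e] at h
  exact ⟨h.2, h.1.symm⟩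

theorem offAxis_tsum_cube_le :
    (Summable fun p => offAxis p * (ternaryForm 1 1 1 p ^ 3)⁻¹) ∧
      ∑' p, offAxis p * (ternaryForm 1 1 1 p ^ 3)⁻¹ ≤ 2 / 9 * (29 / 24) ^ 2 := by
  obtain ⟨h1, h2⟩ := offAxis_tsum_eq sector_tsum_le.1
  refine ⟨h1, ?_⟩
  rw [h2]
  linarith [sector_tsum_le.2]

theorem offAxis_tsum_pow_six_le :
    (Summable fun p => offAxis p * (ternaryForm 1 1 1 p ^ 6)⁻¹) ∧
      ∑' p, offAxis p * (ternaryForm 1 1 1 p ^ 6)⁻¹ ≤ 2 / 243 * (29 / 24) ^ 2 := by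
  have hle : ∀ p, sector p * (ternaryForm 1 1 1 p ^ 6)⁻¹ ≤
      1 / 27 * (sector p * (ternaryForm 1 1 1 p ^ 3)⁻¹) := fun p => by
    unfold sector
    split_ifs with h
    swap
    · simp
    have h1 : (1 : ℝ) ≤ p.1 * p.2 := by exact_mod_cast h
    have hK : 3 ≤ ternaryForm 1 1 1 p := by
      simp only [ternaryForm]
      nlinarith [sq_nonneg ((p.1 : ℝ) - p.2)]
    rw [one_mul, one_mul, show 6 = 3 + 3 from rfl, pow_add, mul_inv]
    gcongr
    rw [one_div]
    apply inv_anti₀ (by norm_num)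
    calc (27 : ℝ) = 3 ^ 3 := by norm_num
      _ ≤ _ := by gcongr
  have h0 : ∀ p, 0 ≤ sector p * (ternaryForm 1 1 1 p ^ 6)⁻¹ := fun p => by
    have := sector_nonneg p
    positivity
  have hsum := sector_tsum_le.1.mul_left (1 / 27)
  have hs := hsum.of_nonneg_of_le h0 hle
  obtain ⟨h1, h2⟩ := offAxis_tsum_eq hs
  refine ⟨h1, ?_⟩
  rw [h2]
  have := hs.tsum_le_tsum hle hsum
  rw [tsum_mul_left] at this
  linarith [sector_tsum_le.2]

theorem ternaryForm_sums (A B C : ℝ) (p : ℤ × ℤ) :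
    ternaryForm A B C p + ternaryForm B C A p + ternaryForm C A B p =
      ternaryForm 1 1 1 p * (A + B + C) ∧
    ternaryForm A B C p ^ 2 + ternaryForm B C A p ^ 2 + ternaryForm C A B p ^ 2 =
      ternaryForm 1 1 1 p ^ 2 * (A ^ 2 + B ^ 2 + C ^ 2) := by
  simp only [ternaryForm]
  constructor <;> ring

theorem inv_ternaryForm_pow_sum_of_axis (A B C : ℝ) (k : ℕ) {p : ℤ × ℤ}
    (h : p.1 * p.2 * (p.1 + p.2) = 0) :
    (ternaryForm A B C p ^ k)⁻¹ + (ternaryForm B C A p ^ k)⁻¹ + (ternaryForm C A B p ^ k)⁻¹ =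
      (ternaryForm 1 1 1 p ^ k)⁻¹ * ((A ^ k)⁻¹ + (B ^ k)⁻¹ + (C ^ k)⁻¹) := by
  obtain ⟨m, n⟩ := p
  simp only [mul_eq_zero] at h
  rcases h with (rfl | rfl) | h
  · simp only [ternaryForm, Int.cast_zero, zero_mul, zero_add, sub_zero, mul_one, mul_pow,
      mul_inv]
    ring
  · simp only [ternaryForm, Int.cast_zero, zero_mul, mul_zero, add_zero, sub_zero, mul_one,
      mul_pow, mul_inv]
    ring
  · obtain rfl : n = -m := by omega
    simp only [ternaryForm, Int.cast_neg, add_neg_cancel, mul_zero, zero_mul, zero_add, mul_neg,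
      neg_mul, sub_neg_eq_add, mul_one, mul_pow, mul_inv]
    ring

theorem ne_zero_of_offAxis {p : ℤ × ℤ} (h : p.1 * p.2 * (p.1 + p.2) ≠ 0) : p ≠ 0 := by
  rintro rfl
  simp at h

/-- The rescaled values on a `hexRotation`-orbit, as a triple with the power sums of `(1, B, C)`. -/
theorem exists_orbit_triple {B C : ℝ} (hB : 1 ≤ B) (hBC : B ≤ C) (hC : C ≤ 1 + B) {p : ℤ × ℤ}
    (hp : p ≠ 0) : ∃ t₁ t₂ t₃ : ℝ, 2 / 3 ≤ t₁ ∧ 2 / 3 ≤ t₂ ∧ 2 / 3 ≤ t₃ ∧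
      t₁ + t₂ + t₃ = 1 + B + C ∧ t₁ ^ 2 + t₂ ^ 2 + t₃ ^ 2 = 1 + B ^ 2 + C ^ 2 ∧
      ternaryForm 1 B C p = ternaryForm 1 1 1 p * t₁ ∧
      ternaryForm B C 1 p = ternaryForm 1 1 1 p * t₂ ∧
      ternaryForm C 1 B p = ternaryForm 1 1 1 p * t₃ := by
  have hK := ternaryForm_hex_pos hp
  have h1 := ternaryForm_ge_hex hB hBC hC p
  have h2 := ternaryForm_ge_hex hB hBC hC (hexRotation p)
  have h3 := ternaryForm_ge_hex hB hBC hC (hexRotation (hexRotation p))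
  simp only [ternaryForm_hexRotation] at h2 h3
  obtain ⟨e1, e2⟩ := ternaryForm_sums 1 B C p
  refine ⟨ternaryForm 1 B C p / ternaryForm 1 1 1 p, ternaryForm B C 1 p / ternaryForm 1 1 1 p,
    ternaryForm C 1 B p / ternaryForm 1 1 1 p, ?_, ?_, ?_, ?_, ?_, ?_, ?_, ?_⟩
  · rwa [le_div_iff₀ hK]
  · rwa [le_div_iff₀ hK]
  · rwa [le_div_iff₀ hK]
  · rw [← add_div, ← add_div, e1]
    field_simp
  · rw [div_pow, div_pow, div_pow, ← add_div, ← add_div, e2]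
    field_simp
  all_goals field_simp

theorem orbit_inv_cube_le {B C : ℝ} (hB : 1 ≤ B) (hBC : B ≤ C) (hC : C ≤ 1 + B) (p : ℤ × ℤ) :
    ((ternaryForm 1 B C p ^ 3)⁻¹ + (ternaryForm B C 1 p ^ 3)⁻¹ + (ternaryForm C 1 B p ^ 3)⁻¹) *
        (1 + (B ^ 3)⁻¹ + (C ^ 3)⁻¹) ≤
      (ternaryForm 1 1 1 p ^ 3)⁻¹ * (1 + (B ^ 3)⁻¹ + (C ^ 3)⁻¹) ^ 2 +
      offAxis p * (ternaryForm 1 1 1 p ^ 3)⁻¹ *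
        (129 / 20 * (3 * (1 + ((B ^ 3)⁻¹) ^ 2 + ((C ^ 3)⁻¹) ^ 2) -
        (1 + (B ^ 3)⁻¹ + (C ^ 3)⁻¹) ^ 2)) := by
  have hK0 : 0 ≤ (ternaryForm 1 1 1 p ^ 3)⁻¹ := by
    have : 0 ≤ ternaryForm 1 1 1 p := le_trans (by positivity) (ternaryForm_hex_ge p)
    positivity
  have hD : 0 ≤ 129 / 20 * (3 * (1 + ((B ^ 3)⁻¹) ^ 2 + ((C ^ 3)⁻¹) ^ 2) -
        (1 + (B ^ 3)⁻¹ + (C ^ 3)⁻¹) ^ 2) := by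
    nlinarith [sq_nonneg (1 - (B ^ 3)⁻¹), sq_nonneg (1 - (C ^ 3)⁻¹),
      sq_nonneg ((B ^ 3)⁻¹ - (C ^ 3)⁻¹)]
  by_cases h : p.1 * p.2 * (p.1 + p.2) = 0
  · rw [inv_ternaryForm_pow_sum_of_axis 1 B C 3 h, one_pow, inv_one]
    have := mul_nonneg (mul_nonneg (offAxis_nonneg p) hK0) hD
    linarith
  · obtain ⟨t₁, t₂, t₃, h₁, h₂, h₃, hs, hq, e1, e2, e3⟩ :=
      exists_orbit_triple hB hBC hC (ne_zero_of_offAxis h)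
    have key := mul_le_mul_of_nonneg_left (sum_inv_cube_mul_le hB hBC hC h₁ h₂ h₃ hs hq) hK0
    have hoff := mul_le_mul_of_nonneg_right (one_le_offAxis h) (mul_nonneg hK0 hD)
    rw [e1, e2, e3, mul_pow, mul_pow, mul_pow, mul_inv, mul_inv, mul_inv]
    linarith

theorem orbit_inv_pow_six_ge {B C : ℝ} (hB : 1 ≤ B) (hBC : B ≤ C) (hC : C ≤ 1 + B)
    (p : ℤ × ℤ) :
    (ternaryForm 1 1 1 p ^ 6)⁻¹ * (1 + ((B ^ 3)⁻¹) ^ 2 + ((C ^ 3)⁻¹) ^ 2) -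
      offAxis p * (ternaryForm 1 1 1 p ^ 6)⁻¹ *
        (139 / 30 * (3 * (1 + ((B ^ 3)⁻¹) ^ 2 + ((C ^ 3)⁻¹) ^ 2) -
        (1 + (B ^ 3)⁻¹ + (C ^ 3)⁻¹) ^ 2)) ≤
    (ternaryForm 1 B C p ^ 6)⁻¹ + (ternaryForm B C 1 p ^ 6)⁻¹ + (ternaryForm C 1 B p ^ 6)⁻¹ := by
  have hK0 : 0 ≤ (ternaryForm 1 1 1 p ^ 6)⁻¹ := by positivity
  have hD : 0 ≤ 139 / 30 * (3 * (1 + ((B ^ 3)⁻¹) ^ 2 + ((C ^ 3)⁻¹) ^ 2) -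
        (1 + (B ^ 3)⁻¹ + (C ^ 3)⁻¹) ^ 2) := by
    nlinarith [sq_nonneg (1 - (B ^ 3)⁻¹), sq_nonneg (1 - (C ^ 3)⁻¹),
      sq_nonneg ((B ^ 3)⁻¹ - (C ^ 3)⁻¹)]
  by_cases h : p.1 * p.2 * (p.1 + p.2) = 0
  · have e : ∀ t : ℝ, (t ^ 6)⁻¹ = ((t ^ 3)⁻¹) ^ 2 := fun t => by rw [inv_pow, ← pow_mul]
    rw [inv_ternaryForm_pow_sum_of_axis 1 B C 6 h, one_pow, inv_one, e B, e C]
    have := mul_nonneg (mul_nonneg (offAxis_nonneg p) hK0) hD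
    linarith
  · obtain ⟨t₁, t₂, t₃, h₁, h₂, h₃, hs, -, e1, e2, e3⟩ :=
      exists_orbit_triple hB hBC hC (ne_zero_of_offAxis h)
    have key := mul_le_mul_of_nonneg_left (sum_inv_pow_six_ge hB hBC hC (by linarith)
      (by linarith) (by linarith) hs) hK0
    have hoff := mul_le_mul_of_nonneg_right (one_le_offAxis h) (mul_nonneg hK0 hD)
    rw [e1, e2, e3, mul_pow, mul_pow, mul_pow, mul_inv, mul_inv, mul_inv]
    linarith

theorem summable_ternaryForm {B C : ℝ} (hB : 1 ≤ B) (hBC : B ≤ C) (hC : C ≤ 1 + B) {k : ℕ}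
    (hk : 2 ≤ k) : Summable fun p : ℤ × ℤ => (ternaryForm 1 B C p ^ k)⁻¹ :=
  summable_inv_pow_of_ge (by norm_num : (0 : ℝ) < 1 / 3) (ternaryForm_zero _ _ _)
    (fun p => by linarith [ternaryForm_ge_hex hB hBC hC p, ternaryForm_hex_ge p]) hk

theorem formZeta_three_le {B C : ℝ} (hB : 1 ≤ B) (hBC : B ≤ C) (hC : C ≤ 1 + B) :
    3 * formZeta 3 1 B C * (1 + (B ^ 3)⁻¹ + (C ^ 3)⁻¹) ≤
      formZeta 3 1 1 1 * (1 + (B ^ 3)⁻¹ + (C ^ 3)⁻¹) ^ 2 +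
      2 / 9 * (29 / 24) ^ 2 * (129 / 20 * (3 * (1 + ((B ^ 3)⁻¹) ^ 2 + ((C ^ 3)⁻¹) ^ 2) -
        (1 + (B ^ 3)⁻¹ + (C ^ 3)⁻¹) ^ 2)) := by
  have hD : 0 ≤ 129 / 20 * (3 * (1 + ((B ^ 3)⁻¹) ^ 2 + ((C ^ 3)⁻¹) ^ 2) -
        (1 + (B ^ 3)⁻¹ + (C ^ 3)⁻¹) ^ 2) := by
    nlinarith [sq_nonneg (1 - (B ^ 3)⁻¹), sq_nonneg (1 - (C ^ 3)⁻¹),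
      sq_nonneg ((B ^ 3)⁻¹ - (C ^ 3)⁻¹)]
  obtain ⟨h1, h2⟩ := three_mul_tsum (summable_ternaryForm hB hBC hC (by norm_num : 2 ≤ 3))
  simp only [ternaryForm_hexRotation] at h1 h2
  obtain ⟨hO, hO'⟩ := offAxis_tsum_cube_le
  have hH := summable_ternaryForm_hex (by norm_num : 2 ≤ 3)
  have key := (h2.mul_right _).tsum_le_tsum (orbit_inv_cube_le hB hBC hC)
    ((hH.mul_right _).add (hO.mul_right _))
  rw [(hH.mul_right _).tsum_add (hO.mul_right _), tsum_mul_right, tsum_mul_right, tsum_mul_right,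
    ← h1] at key
  have := mul_le_mul_of_nonneg_right hO' hD
  simp only [formZeta]
  linarith

theorem formZeta_six_ge {B C : ℝ} (hB : 1 ≤ B) (hBC : B ≤ C) (hC : C ≤ 1 + B) :
    formZeta 6 1 1 1 * (1 + ((B ^ 3)⁻¹) ^ 2 + ((C ^ 3)⁻¹) ^ 2) -
      2 / 243 * (29 / 24) ^ 2 * (139 / 30 * (3 * (1 + ((B ^ 3)⁻¹) ^ 2 + ((C ^ 3)⁻¹) ^ 2) -
        (1 + (B ^ 3)⁻¹ + (C ^ 3)⁻¹) ^ 2)) ≤ 3 * formZeta 6 1 B C := by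
  have hD : 0 ≤ 139 / 30 * (3 * (1 + ((B ^ 3)⁻¹) ^ 2 + ((C ^ 3)⁻¹) ^ 2) -
        (1 + (B ^ 3)⁻¹ + (C ^ 3)⁻¹) ^ 2) := by
    nlinarith [sq_nonneg (1 - (B ^ 3)⁻¹), sq_nonneg (1 - (C ^ 3)⁻¹),
      sq_nonneg ((B ^ 3)⁻¹ - (C ^ 3)⁻¹)]
  obtain ⟨h1, h2⟩ := three_mul_tsum (summable_ternaryForm hB hBC hC (by norm_num : 2 ≤ 6))
  simp only [ternaryForm_hexRotation] at h1 h2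
  obtain ⟨hO, hO'⟩ := offAxis_tsum_pow_six_le
  have hH := summable_ternaryForm_hex (by norm_num : 2 ≤ 6)
  have key := ((hH.mul_right _).sub (hO.mul_right _)).tsum_le_tsum
    (orbit_inv_pow_six_ge hB hBC hC) h2
  rw [(hH.mul_right _).tsum_sub (hO.mul_right _), tsum_mul_right, tsum_mul_right, ← h1] at key
  have := mul_le_mul_of_nonneg_right hO' hD
  simp only [formZeta]
  linarith

theorem ratio_bound {S T G H M D : ℝ} (hG : 6 ≤ G) (hH : 6 ≤ H) (hM : 0 < M) (hD : 0 ≤ D)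
    (hDM : D ≤ 2 * M ^ 2) (hS0 : 0 ≤ S)
    (hS : 3 * S * M ≤ G * M ^ 2 + 2.0929 * D)
    (hT : H * ((D + M ^ 2) / 3) - 0.0558 * D ≤ 3 * T) :
    H * S ^ 2 + D / 9 ≤ G ^ 2 * T := by
  have h1 : (3 * S * M) ^ 2 ≤ (G * M ^ 2 + 2.0929 * D) ^ 2 := by gcongr
  have h2 : D ^ 2 ≤ 2 * M ^ 2 * D := by nlinarith
  have h3 : (3 * S * M) ^ 2 ≤ G ^ 2 * M ^ 4 + M ^ 2 * D * (2 * 2.0929 * G + 2 * 2.0929 ^ 2) := by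
    nlinarith
  have h4 : 9 * S ^ 2 ≤ G ^ 2 * M ^ 2 + D * (2 * 2.0929 * G + 2 * 2.0929 ^ 2) := by
    have hM2 : 0 < M ^ 2 := by positivity
    refine le_of_mul_le_mul_left ?_ hM2
    nlinarith
  have h5 := mul_le_mul_of_nonneg_left h4 (by linarith : 0 ≤ H)
  have h6 := mul_le_mul_of_nonneg_left hT (by positivity : 0 ≤ 3 * G ^ 2)
  have h7 : 0 ≤ D * (H * (G ^ 2 - (2 * 2.0929 * G + 2 * 2.0929 ^ 2)) - 3 * 0.0558 * G ^ 2 - 1) := by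
    refine mul_nonneg hD ?_
    have h8 : 0 ≤ G ^ 2 - (2 * 2.0929 * G + 2 * 2.0929 ^ 2) := by nlinarith
    have h9 := mul_le_mul_of_nonneg_right hH h8
    nlinarith
  nlinarith

/-- Among reduced forms, the hexagonal form is the unique maximizer of `ζ(3)² / ζ(6)`. -/
theorem hex_mul_formZeta_sq_le {A B C : ℝ} (hA : 0 < A) (hAB : A ≤ B) (hBC : B ≤ C)
    (hC : C ≤ A + B) :
    formZeta 6 1 1 1 * formZeta 3 A B C ^ 2 ≤ formZeta 3 1 1 1 ^ 2 * formZeta 6 A B C ∧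
    (formZeta 6 1 1 1 * formZeta 3 A B C ^ 2 = formZeta 3 1 1 1 ^ 2 * formZeta 6 A B C →
      B = A ∧ C = A) := by
  obtain ⟨b, rfl⟩ : ∃ b, B = A * b := ⟨B / A, by field_simp⟩
  obtain ⟨c, rfl⟩ : ∃ c, C = A * c := ⟨C / A, by field_simp⟩
  have hb : 1 ≤ b := le_of_mul_le_mul_left (by linarith) hA
  have hbc : b ≤ c := le_of_mul_le_mul_left hBC hA
  have hc : c ≤ 1 + b := le_of_mul_le_mul_left (by linarith) hA
  have e : ∀ k, formZeta k A (A * b) (A * c) = (A ^ k)⁻¹ * formZeta k 1 b c := fun k => by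
    rw [← formZeta_smul, mul_one]
  have h3 := formZeta_three_le hb hbc hc
  have h6 := formZeta_six_ge hb hbc hc
  have hS0 : 0 ≤ formZeta 3 1 b c := tsum_nonneg fun p => by
    have h1 := ternaryForm_ge_hex hb hbc hc p
    have h2 : 0 ≤ ternaryForm 1 1 1 p := le_trans (by positivity) (ternaryForm_hex_ge p)
    have : 0 ≤ ternaryForm 1 b c p := by linarith
    positivity
  have hy : 0 < (b ^ 3)⁻¹ := by positivity
  have hc0 : 0 < c := by linarith
  have hz : 0 < (c ^ 3)⁻¹ := by positivity
  have hD0 : 0 ≤ 3 * (1 + ((b ^ 3)⁻¹) ^ 2 + ((c ^ 3)⁻¹) ^ 2) -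
      (1 + (b ^ 3)⁻¹ + (c ^ 3)⁻¹) ^ 2 := by
    nlinarith [sq_nonneg (1 - (b ^ 3)⁻¹), sq_nonneg (1 - (c ^ 3)⁻¹),
      sq_nonneg ((b ^ 3)⁻¹ - (c ^ 3)⁻¹)]
  set M := 1 + (b ^ 3)⁻¹ + (c ^ 3)⁻¹ with hM
  set D := 3 * (1 + ((b ^ 3)⁻¹) ^ 2 + ((c ^ 3)⁻¹) ^ 2) - M ^ 2 with hD
  have hN : 1 + ((b ^ 3)⁻¹) ^ 2 + ((c ^ 3)⁻¹) ^ 2 = (D + M ^ 2) / 3 := by rw [hD]; ring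
  have hDM : D ≤ 2 * M ^ 2 := by
    rw [hD, hM]
    nlinarith [mul_pos hy hz]
  rw [hN] at h6
  have key := ratio_bound (six_le_formZeta_hex (by norm_num : 2 ≤ 3))
    (six_le_formZeta_hex (by norm_num : 2 ≤ 6)) (M := M) (by positivity) hD0 hDM hS0
    (by linarith) (T := formZeta 6 1 b c) (by linarith)
  rw [e, e]
  have hA6 : 0 < (A ^ 6)⁻¹ := by positivity
  have e1 : formZeta 6 1 1 1 * ((A ^ 3)⁻¹ * formZeta 3 1 b c) ^ 2 =
      (A ^ 6)⁻¹ * (formZeta 6 1 1 1 * formZeta 3 1 b c ^ 2) := by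
    rw [mul_pow, inv_pow, ← pow_mul]; ring
  have e2 : formZeta 3 1 1 1 ^ 2 * ((A ^ 6)⁻¹ * formZeta 6 1 b c) =
      (A ^ 6)⁻¹ * (formZeta 3 1 1 1 ^ 2 * formZeta 6 1 b c) := by ring
  rw [e1, e2]
  refine ⟨mul_le_mul_of_nonneg_left (by linarith) hA6.le, fun h => ?_⟩
  have h' := mul_left_cancel₀ hA6.ne' h
  have hz1 : (c ^ 3)⁻¹ = 1 := by
    have : (1 - (c ^ 3)⁻¹) ^ 2 ≤ 0 := by
      nlinarith [sq_nonneg (1 - (b ^ 3)⁻¹), sq_nonneg ((b ^ 3)⁻¹ - (c ^ 3)⁻¹)]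
    have := pow_eq_zero_iff (two_ne_zero) |>.1 (le_antisymm this (sq_nonneg _))
    linarith
  have hc1 : c = 1 := by
    rw [inv_eq_one] at hz1
    exact (pow_eq_one_iff_of_nonneg hc0.le (by norm_num)).1 hz1
  have hb1 : b = 1 := by linarith
  simp [hc1, hb1]

theorem norm_sq_smul_add_smul (u v : EuclideanSpace ℝ (Fin 2)) (x y : ℝ) :
    ‖x • u + y • v‖ ^ 2 =
      x * (x + y) * ‖u‖ ^ 2 + y * (x + y) * ‖v‖ ^ 2 - x * y * ‖u - v‖ ^ 2 := by
  simp only [EuclideanSpace.norm_sq_eq, Fin.sum_univ_two, PiLp.add_apply, PiLp.sub_apply,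
    PiLp.smul_apply, smul_eq_mul, Real.norm_eq_abs, sq_abs]
  ring

theorem four_mul_det2_sq (u v : EuclideanSpace ℝ (Fin 2)) :
    4 * det2 u v ^ 2 =
      4 * ‖u‖ ^ 2 * ‖v‖ ^ 2 - (‖u‖ ^ 2 + ‖v‖ ^ 2 - ‖u - v‖ ^ 2) ^ 2 := by
  simp only [det2, EuclideanSpace.norm_sq_eq, Fin.sum_univ_two, PiLp.sub_apply,
    Real.norm_eq_abs, sq_abs]
  ring

theorem det2_sq_mul_le (u v : EuclideanSpace ℝ (Fin 2)) (x y : ℝ) :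
    det2 u v ^ 2 * (x ^ 2 + y ^ 2) ≤ (‖u‖ ^ 2 + ‖v‖ ^ 2) * ‖x • u + y • v‖ ^ 2 := by
  simp only [det2, EuclideanSpace.norm_sq_eq, Fin.sum_univ_two, PiLp.add_apply,
    PiLp.smul_apply, smul_eq_mul, Real.norm_eq_abs, sq_abs]
  linarith [sq_nonneg ((u 0 ^ 2 + u 1 ^ 2) * x + (u 0 * v 0 + u 1 * v 1) * y),
    sq_nonneg ((u 0 * v 0 + u 1 * v 1) * x + (v 0 ^ 2 + v 1 ^ 2) * y)]

theorem norm_sq_add_norm_sq_pos {u v : EuclideanSpace ℝ (Fin 2)} (h : det2 u v ≠ 0) :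
    0 < ‖u‖ ^ 2 + ‖v‖ ^ 2 := by
  refine lt_of_le_of_ne (by positivity) fun h0 => h ?_
  have hu : u = 0 := norm_eq_zero.1 (pow_eq_zero_iff two_ne_zero |>.1
    (by nlinarith [sq_nonneg ‖u‖, sq_nonneg ‖v‖]))
  simp [hu, det2]

theorem eq_zero_of_smul_add_smul_eq_zero {u v : EuclideanSpace ℝ (Fin 2)} (h : det2 u v ≠ 0)
    {x y : ℝ} (hxy : x • u + y • v = 0) : x = 0 ∧ y = 0 := by
  have h1 := det2_sq_mul_le u v x y
  rw [hxy, norm_zero] at h1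
  have h2 : 0 < det2 u v ^ 2 := by positivity
  have h3 : x ^ 2 + y ^ 2 ≤ 0 := by
    by_contra! h3
    nlinarith [mul_pos h2 h3]
  constructor <;> nlinarith [sq_nonneg x, sq_nonneg y]

/-- The point of `latticeSet u v` with the given integer coordinates. -/
def latticePoint (u v : EuclideanSpace ℝ (Fin 2)) (p : ℤ × ℤ) : EuclideanSpace ℝ (Fin 2) :=
  (p.1 : ℝ) • u + (p.2 : ℝ) • v

theorem latticeSet_eq_range (u v : EuclideanSpace ℝ (Fin 2)) :
    latticeSet u v = Set.range (latticePoint u v) := by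
  ext x
  constructor
  · rintro ⟨m, n, rfl⟩
    exact ⟨(m, n), rfl⟩
  · rintro ⟨p, rfl⟩
    exact ⟨p.1, p.2, rfl⟩

theorem latticePoint_injective {u v : EuclideanSpace ℝ (Fin 2)} (h : det2 u v ≠ 0) :
    Function.Injective (latticePoint u v) := by
  intro p q hpq
  have h0 : ((p.1 : ℝ) - q.1) • u + ((p.2 : ℝ) - q.2) • v = 0 := by
    have := sub_eq_zero.2 hpq
    simp only [latticePoint] at this
    rw [← this]
    module
  obtain ⟨h1, h2⟩ := eq_zero_of_smul_add_smul_eq_zero h h0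
  exact Prod.ext (by exact_mod_cast sub_eq_zero.1 h1) (by exact_mod_cast sub_eq_zero.1 h2)

theorem norm_latticePoint_sq (u v : EuclideanSpace ℝ (Fin 2)) (p : ℤ × ℤ) :
    ‖latticePoint u v p‖ ^ 2 = ternaryForm (‖u‖ ^ 2) (‖v‖ ^ 2) (‖u - v‖ ^ 2) p :=
  norm_sq_smul_add_smul u v p.1 p.2

theorem mul_sq_add_sq_le_norm_latticePoint_sq {u v : EuclideanSpace ℝ (Fin 2)}
    (h : det2 u v ≠ 0) (p : ℤ × ℤ) :
    det2 u v ^ 2 / (‖u‖ ^ 2 + ‖v‖ ^ 2) * ((p.1 : ℝ) ^ 2 + (p.2 : ℝ) ^ 2) ≤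
      ‖latticePoint u v p‖ ^ 2 := by
  rw [div_mul_eq_mul_div, div_le_iff₀ (norm_sq_add_norm_sq_pos h), mul_comm (‖_‖ ^ 2)]
  exact det2_sq_mul_le u v p.1 p.2

theorem summable_ternaryForm_norm_sq {u v : EuclideanSpace ℝ (Fin 2)} (h : det2 u v ≠ 0) {k : ℕ}
    (hk : 2 ≤ k) :
    Summable fun p => (ternaryForm (‖u‖ ^ 2) (‖v‖ ^ 2) (‖u - v‖ ^ 2) p ^ k)⁻¹ := by
  have hpos := norm_sq_add_norm_sq_pos h
  refine summable_inv_pow_of_ge (c := det2 u v ^ 2 / (‖u‖ ^ 2 + ‖v‖ ^ 2)) (by positivity)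
    (ternaryForm_zero _ _ _) (fun p => ?_) hk
  rw [← norm_latticePoint_sq]
  exact mul_sq_add_sq_le_norm_latticePoint_sq h p

theorem tsum_latticeSet_diff_zero {u v : EuclideanSpace ℝ (Fin 2)} (h : det2 u v ≠ 0)
    {f : EuclideanSpace ℝ (Fin 2) → ℝ} (hf : f 0 = 0) :
    ∑' x : ↥(latticeSet u v \ {0}), f x = ∑' p, f (latticePoint u v p) := by
  have h1 : (latticeSet u v \ {0}).indicator f = (latticeSet u v).indicator f := by
    ext x
    by_cases hx : x = 0
    · simp [Set.indicator, hx, hf]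
    · by_cases hxL : x ∈ latticeSet u v
      · rw [Set.indicator_of_mem hxL, Set.indicator_of_mem (Set.mem_sdiff_of_mem hxL hx)]
      · rw [Set.indicator_of_notMem hxL, Set.indicator_of_notMem fun h => hxL h.1]
  rw [tsum_subtype, h1, ← tsum_subtype, latticeSet_eq_range]
  exact tsum_range f (latticePoint_injective h)

theorem norm_rpow_neg_twelve (x : EuclideanSpace ℝ (Fin 2)) :
    ‖x‖ ^ (-12 : ℝ) = ((‖x‖ ^ 2) ^ 6)⁻¹ := by
  rw [Real.rpow_neg (norm_nonneg x), ← pow_mul]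
  norm_cast

theorem norm_rpow_neg_six (x : EuclideanSpace ℝ (Fin 2)) :
    ‖x‖ ^ (-6 : ℝ) = ((‖x‖ ^ 2) ^ 3)⁻¹ := by
  rw [Real.rpow_neg (norm_nonneg x), ← pow_mul]
  norm_cast

theorem epsteinZeta_latticeSet_twelve {u v : EuclideanSpace ℝ (Fin 2)} (h : det2 u v ≠ 0) :
    epsteinZeta (latticeSet u v) 12 = formZeta 6 (‖u‖ ^ 2) (‖v‖ ^ 2) (‖u - v‖ ^ 2) := by
  simp only [epsteinZeta, norm_rpow_neg_twelve, formZeta, ← norm_latticePoint_sq]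
  exact tsum_latticeSet_diff_zero h (f := fun x => ((‖x‖ ^ 2) ^ 6)⁻¹) (by simp)

theorem epsteinZeta_latticeSet_six {u v : EuclideanSpace ℝ (Fin 2)} (h : det2 u v ≠ 0) :
    epsteinZeta (latticeSet u v) 6 = formZeta 3 (‖u‖ ^ 2) (‖v‖ ^ 2) (‖u - v‖ ^ 2) := by
  simp only [epsteinZeta, norm_rpow_neg_six, formZeta, ← norm_latticePoint_sq]
  exact tsum_latticeSet_diff_zero h (f := fun x => ((‖x‖ ^ 2) ^ 3)⁻¹) (by simp)

theorem LJenergy_latticeSet (a b : ℝ) {u v : EuclideanSpace ℝ (Fin 2)} (h : det2 u v ≠ 0) :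
    LJenergy a b 12 6 (latticeSet u v) =
      a * formZeta 6 (‖u‖ ^ 2) (‖v‖ ^ 2) (‖u - v‖ ^ 2) -
        b * formZeta 3 (‖u‖ ^ 2) (‖v‖ ^ 2) (‖u - v‖ ^ 2) := by
  have h6 := summable_ternaryForm_norm_sq h (by norm_num : 2 ≤ 6)
  have h3 := summable_ternaryForm_norm_sq h (by norm_num : 2 ≤ 3)
  simp only [LJenergy, norm_rpow_neg_twelve, norm_rpow_neg_six, formZeta]
  rw [tsum_latticeSet_diff_zero h
    (f := fun x => a * ((‖x‖ ^ 2) ^ 6)⁻¹ - b * ((‖x‖ ^ 2) ^ 3)⁻¹) (by simp)]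
  simp only [norm_latticePoint_sq]
  rw [(h6.mul_left a).tsum_sub (h3.mul_left b), tsum_mul_left, tsum_mul_left]

theorem formZeta_norm_sq_pos {u v : EuclideanSpace ℝ (Fin 2)} (h : det2 u v ≠ 0) {k : ℕ}
    (hk : 2 ≤ k) : 0 < formZeta k (‖u‖ ^ 2) (‖v‖ ^ 2) (‖u - v‖ ^ 2) := by
  refine (summable_ternaryForm_norm_sq h hk).tsum_pos (fun p => ?_) (1, 0) ?_
  · rw [← norm_latticePoint_sq]
    positivity
  · have hu : 0 < ‖u‖ := norm_pos_iff.2 fun hu => h (by simp [hu, det2])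
    simp only [ternaryForm, Int.cast_one, Int.cast_zero, add_zero, mul_one, one_mul, zero_mul,
      mul_zero, sub_zero]
    positivity

theorem latticeSet_add_right (u v : EuclideanSpace ℝ (Fin 2)) :
    latticeSet u (v + u) = latticeSet u v := by
  ext x
  constructor
  · rintro ⟨m, n, rfl⟩
    exact ⟨m + n, n, by push_cast; module⟩
  · rintro ⟨m, n, rfl⟩
    exact ⟨m - n, n, by push_cast; module⟩

theorem latticeSet_neg_right (u v : EuclideanSpace ℝ (Fin 2)) :
    latticeSet u (-v) = latticeSet u v := by
  ext x
  constructor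
  · rintro ⟨m, n, rfl⟩
    exact ⟨m, -n, by push_cast; module⟩
  · rintro ⟨m, n, rfl⟩
    exact ⟨m, -n, by push_cast; module⟩

theorem latticeSet_comm (u v : EuclideanSpace ℝ (Fin 2)) : latticeSet v u = latticeSet u v := by
  ext x
  constructor
  · rintro ⟨m, n, rfl⟩
    exact ⟨n, m, add_comm _ _⟩
  · rintro ⟨m, n, rfl⟩
    exact ⟨n, m, add_comm _ _⟩

theorem finite_latticeSet_norm_sq_le {u v : EuclideanSpace ℝ (Fin 2)} (h : det2 u v ≠ 0) (R : ℝ) :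
    {x ∈ latticeSet u v | ‖x‖ ^ 2 ≤ R}.Finite := by
  have hpos := norm_sq_add_norm_sq_pos h
  set c := det2 u v ^ 2 / (‖u‖ ^ 2 + ‖v‖ ^ 2) with hc
  have hc0 : 0 < c := by positivity
  obtain ⟨N, hN⟩ := exists_nat_ge (R / c)
  have key : ∀ k : ℤ, (k : ℝ) ^ 2 ≤ N → k ∈ Set.Icc (-(N : ℤ)) N := fun k hk => by
    have hk' : k ^ 2 ≤ N := by exact_mod_cast hk
    constructor <;> nlinarith
  refine (((Set.finite_Icc (-(N : ℤ)) N).prod (Set.finite_Icc (-(N : ℤ)) N)).image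
    (latticePoint u v)).subset ?_
  rintro x ⟨hx, hxR⟩
  rw [latticeSet_eq_range] at hx
  obtain ⟨p, rfl⟩ := hx
  have h1 := mul_sq_add_sq_le_norm_latticePoint_sq h p
  rw [← hc] at h1
  have h2 : (p.1 : ℝ) ^ 2 + (p.2 : ℝ) ^ 2 ≤ N := by
    refine le_trans ?_ hN
    rw [le_div_iff₀ hc0]
    linarith
  exact ⟨p, ⟨key _ (by nlinarith [sq_nonneg (p.2 : ℝ)]),
    key _ (by nlinarith [sq_nonneg (p.1 : ℝ)])⟩, rfl⟩

/-- Among the bases of a lattice there is one with the least sum of squared lengths. -/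
theorem exists_min_basis {L : Set (EuclideanSpace ℝ (Fin 2))} (hL : IsLattice2 L) :
    ∃ u v, det2 u v ≠ 0 ∧ L = latticeSet u v ∧ ∀ u' v', det2 u' v' ≠ 0 → L = latticeSet u' v' →
      ‖u‖ ^ 2 + ‖v‖ ^ 2 ≤ ‖u'‖ ^ 2 + ‖v'‖ ^ 2 := by
  obtain ⟨u₀, v₀, h₀, hL₀⟩ := hL
  set R := ‖u₀‖ ^ 2 + ‖v₀‖ ^ 2 with hR
  have hfin := finite_latticeSet_norm_sq_le h₀ R
  have hmem : ∀ {u v}, L = latticeSet u v → u ∈ latticeSet u₀ v₀ ∧ v ∈ latticeSet u₀ v₀ :=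
    fun {u v} h => by
      rw [← hL₀, h]
      exact ⟨⟨1, 0, by simp⟩, ⟨0, 1, by simp⟩⟩
  obtain ⟨⟨u, v⟩, ⟨h1, h2, -⟩, hmin⟩ := Set.exists_min_image
    {x : EuclideanSpace ℝ (Fin 2) × EuclideanSpace ℝ (Fin 2) | det2 x.1 x.2 ≠ 0 ∧
      L = latticeSet x.1 x.2 ∧ ‖x.1‖ ^ 2 + ‖x.2‖ ^ 2 ≤ R} (fun x => ‖x.1‖ ^ 2 + ‖x.2‖ ^ 2)
    ((hfin.prod hfin).subset fun x ⟨_, h2, h3⟩ =>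
      ⟨⟨(hmem h2).1, by nlinarith [sq_nonneg ‖x.2‖]⟩,
        ⟨(hmem h2).2, by nlinarith [sq_nonneg ‖x.1‖]⟩⟩)
    ⟨(u₀, v₀), h₀, hL₀, le_rfl⟩
  refine ⟨u, v, h1, h2, fun u' v' h1' h2' => ?_⟩
  rcases le_total (‖u'‖ ^ 2 + ‖v'‖ ^ 2) R with h | h
  · exact hmin (u', v') ⟨h1', h2', h⟩
  · exact (hmin (u₀, v₀) ⟨h₀, hL₀, le_rfl⟩).trans h

theorem det2_add_right (u v : EuclideanSpace ℝ (Fin 2)) : det2 u (v + u) = det2 u v := by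
  simp only [det2, PiLp.add_apply]
  ring

theorem det2_neg_right (u v : EuclideanSpace ℝ (Fin 2)) : det2 u (-v) = -det2 u v := by
  simp only [det2, PiLp.neg_apply]
  ring

theorem det2_swap (u v : EuclideanSpace ℝ (Fin 2)) : det2 v u = -det2 u v := by
  simp only [det2]
  ring

theorem norm_add_sq_add_norm_sub_sq (u v : EuclideanSpace ℝ (Fin 2)) :
    ‖u + v‖ ^ 2 + ‖u - v‖ ^ 2 = 2 * (‖u‖ ^ 2 + ‖v‖ ^ 2) := by
  have := parallelogram_law_with_norm ℝ u v
  linarith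

/-- Lagrange reduction of plane lattices. -/
theorem exists_reduced_basis {L : Set (EuclideanSpace ℝ (Fin 2))} (hL : IsLattice2 L) :
    ∃ u v, det2 u v ≠ 0 ∧ L = latticeSet u v ∧ ‖u‖ ^ 2 ≤ ‖v‖ ^ 2 ∧ ‖v‖ ^ 2 ≤ ‖u - v‖ ^ 2 ∧
      ‖u - v‖ ^ 2 ≤ ‖u‖ ^ 2 + ‖v‖ ^ 2 := by
  obtain ⟨u, v, h1, h2, hmin⟩ : ∃ u v, det2 u v ≠ 0 ∧ L = latticeSet u v ∧
      ‖u‖ ^ 2 ≤ ‖v‖ ^ 2 ∧ ‖v‖ ^ 2 ≤ ‖u - v‖ ^ 2 ∧ ‖v‖ ^ 2 ≤ ‖u + v‖ ^ 2 := by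
    obtain ⟨u, v, h1, h2, hmin⟩ := exists_min_basis hL
    have hsub : ∀ u v, det2 u v ≠ 0 → L = latticeSet u v →
        det2 u (v - u) ≠ 0 ∧ L = latticeSet u (v - u) := fun u v h1 h2 => by
      rw [← det2_add_right, ← latticeSet_add_right, sub_add_cancel]
      exact ⟨h1, h2⟩
    have hadd : ∀ u v, det2 u v ≠ 0 → L = latticeSet u v →
        det2 u (v + u) ≠ 0 ∧ L = latticeSet u (v + u) := fun u v h1 h2 => by
      rw [det2_add_right, latticeSet_add_right]
      exact ⟨h1, h2⟩
    have h1' : det2 v u ≠ 0 := by rwa [det2_swap, neg_ne_zero]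
    have h2' : L = latticeSet v u := by rwa [latticeSet_comm]
    rcases le_total (‖u‖ ^ 2) (‖v‖ ^ 2) with h | h
    · refine ⟨u, v, h1, h2, h, ?_, ?_⟩
      · have := hmin _ _ (hsub u v h1 h2).1 (hsub u v h1 h2).2
        rw [norm_sub_rev u v]
        linarith
      · have := hmin _ _ (hadd u v h1 h2).1 (hadd u v h1 h2).2
        rw [add_comm u v]
        linarith
    · refine ⟨v, u, h1', h2', h, ?_, ?_⟩
      · have := hmin _ _ (hsub v u h1' h2').1 (hsub v u h1' h2').2
        rw [norm_sub_rev v u]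
        linarith
      · have := hmin _ _ (hadd v u h1' h2').1 (hadd v u h1' h2').2
        rw [add_comm v u]
        linarith
  have hpar := norm_add_sq_add_norm_sub_sq u v
  rcases le_total (‖u - v‖ ^ 2) (‖u + v‖ ^ 2) with h | h
  · exact ⟨u, v, h1, h2, hmin.1, hmin.2.1, by linarith⟩
  · refine ⟨u, -v, by rwa [det2_neg_right, neg_ne_zero], by rwa [latticeSet_neg_right], ?_⟩
    rw [norm_neg, sub_neg_eq_add]
    exact ⟨hmin.1, hmin.2.2, by linarith⟩

/-- Bases with the same Gram matrix differ by a linear isometry. -/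
theorem exists_linearIsometryEquiv {u v u' v' : EuclideanSpace ℝ (Fin 2)} (h : det2 u v ≠ 0)
    (hu : ‖u'‖ ^ 2 = ‖u‖ ^ 2) (hv : ‖v'‖ ^ 2 = ‖v‖ ^ 2) (huv : ‖u' - v'‖ ^ 2 = ‖u - v‖ ^ 2) :
    ∃ O : EuclideanSpace ℝ (Fin 2) ≃ₗᵢ[ℝ] EuclideanSpace ℝ (Fin 2), O u = u' ∧ O v = v' := by
  have hli : LinearIndependent ℝ ![u, v] := LinearIndependent.pair_iff.2 fun x y hxy =>
    eq_zero_of_smul_add_smul_eq_zero h hxy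
  let e := basisOfLinearIndependentOfCardEqFinrank hli (by simp)
  have e0 : e 0 = u := by simp [e]
  have e1 : e 1 = v := by simp [e]
  let f : EuclideanSpace ℝ (Fin 2) →ₗ[ℝ] EuclideanSpace ℝ (Fin 2) := e.constr ℝ ![u', v']
  have f0 : f u = u' := by
    rw [← e0]
    simp [f]
  have f1 : f v = v' := by
    rw [← e1]
    simp [f]
  have hnorm : ∀ x, ‖f x‖ = ‖x‖ := fun x => by
    obtain ⟨s, t, rfl⟩ : ∃ s t : ℝ, x = s • u + t • v :=
      ⟨e.repr x 0, e.repr x 1, by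
        conv_lhs => rw [← e.sum_repr x, Fin.sum_univ_two, e0, e1]⟩
    rw [map_add, map_smul, map_smul, f0, f1, ← sq_eq_sq₀ (norm_nonneg _) (norm_nonneg _),
      norm_sq_smul_add_smul, norm_sq_smul_add_smul, hu, hv, huv]
  exact ⟨LinearIsometry.toLinearIsometryEquiv ⟨f, hnorm⟩ rfl, f0, f1⟩

theorem image_latticeSet (O : EuclideanSpace ℝ (Fin 2) ≃ₗᵢ[ℝ] EuclideanSpace ℝ (Fin 2))
    (u v : EuclideanSpace ℝ (Fin 2)) : O '' latticeSet u v = latticeSet (O u) (O v) := by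
  ext x
  constructor
  · rintro ⟨_, ⟨m, n, rfl⟩, rfl⟩
    exact ⟨m, n, by simp⟩
  · rintro ⟨m, n, rfl⟩
    exact ⟨_, ⟨m, n, rfl⟩, by simp⟩

theorem smul_latticeSet (r : ℝ) (u v : EuclideanSpace ℝ (Fin 2)) :
    r • latticeSet u v = latticeSet (r • u) (r • v) := by
  ext x
  rw [Set.mem_smul_set]
  constructor
  · rintro ⟨_, ⟨m, n, rfl⟩, rfl⟩
    exact ⟨m, n, by module⟩
  · rintro ⟨m, n, rfl⟩
    exact ⟨_, ⟨m, n, rfl⟩, by module⟩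

theorem LJenergy_image_latticeSet (a b : ℝ)
    (O : EuclideanSpace ℝ (Fin 2) ≃ₗᵢ[ℝ] EuclideanSpace ℝ (Fin 2))
    {u v : EuclideanSpace ℝ (Fin 2)} (h : det2 u v ≠ 0) :
    LJenergy a b 12 6 (O '' latticeSet u v) = LJenergy a b 12 6 (latticeSet u v) := by
  have hsub : ‖O u - O v‖ = ‖u - v‖ := by rw [← map_sub, O.norm_map]
  have h' : det2 (O u) (O v) ≠ 0 := fun h0 => by
    have h1 := four_mul_det2_sq (O u) (O v)
    rw [hsub, O.norm_map, O.norm_map, ← four_mul_det2_sq, h0] at h1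
    have : 0 < det2 u v ^ 2 := by positivity
    linarith
  rw [image_latticeSet, LJenergy_latticeSet a b h', LJenergy_latticeSet a b h, hsub,
    O.norm_map, O.norm_map]

/-- Squared lengths in a basis of the triangular lattice. -/
theorem exists_triangularLattice_basis : ∃ u v : EuclideanSpace ℝ (Fin 2), ∃ t : ℝ, 0 < t ∧
    triangularLattice = latticeSet u v ∧ ‖u‖ ^ 2 = t ∧ ‖v‖ ^ 2 = t ∧ ‖u - v‖ ^ 2 = t := by
  have h3 : Real.sqrt 3 ^ 2 = 3 := Real.sq_sqrt (by norm_num)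
  have ht : Real.sqrt (2 / Real.sqrt 3) ^ 2 = 2 / Real.sqrt 3 := Real.sq_sqrt (by positivity)
  refine ⟨_, _, 2 / Real.sqrt 3, by positivity, rfl, ?_, ?_, ?_⟩
  · simp only [norm_smul, mul_pow, vec2, EuclideanSpace.norm_sq_eq, Fin.sum_univ_two,
      Real.norm_eq_abs, sq_abs, ht]
    simp
  · simp only [norm_smul, mul_pow, vec2, EuclideanSpace.norm_sq_eq, Fin.sum_univ_two,
      Real.norm_eq_abs, sq_abs, ht]
    simp [h3, div_pow]
    norm_num
  · rw [← smul_sub]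
    simp only [norm_smul, mul_pow, vec2, EuclideanSpace.norm_sq_eq, Fin.sum_univ_two,
      Real.norm_eq_abs, sq_abs, ht]
    simp [h3, div_pow]
    norm_num

theorem det2_ne_zero_of_equilateral {u v : EuclideanSpace ℝ (Fin 2)} {t : ℝ} (ht : 0 < t)
    (hu : ‖u‖ ^ 2 = t) (hv : ‖v‖ ^ 2 = t) (huv : ‖u - v‖ ^ 2 = t) : det2 u v ≠ 0 := fun h0 => by
  have h1 := four_mul_det2_sq u v
  rw [hu, hv, huv, h0] at h1
  nlinarith [mul_pos ht ht]

theorem formZeta_self (k : ℕ) (t : ℝ) : formZeta k t t t = (t ^ k)⁻¹ * formZeta k 1 1 1 := by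
  rw [← formZeta_smul, mul_one]

theorem LJ_lower_bound {a b H₃ H₆ S₃ S₆ w : ℝ} (ha : 0 < a) (hb : 0 < b) (hH₆ : 0 < H₆)
    (hS₆ : 0 < S₆) (hw : 0 < w) (hwH : w * (b * H₃) = 2 * a * H₆)
    (hS : H₆ * S₃ ^ 2 ≤ H₃ ^ 2 * S₆) :
    a * ((w ^ 2)⁻¹ * H₆) - b * (w⁻¹ * H₃) ≤ a * S₆ - b * S₃ ∧
    (a * S₆ - b * S₃ = a * ((w ^ 2)⁻¹ * H₆) - b * (w⁻¹ * H₃) →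
      H₆ * S₃ ^ 2 = H₃ ^ 2 * S₆ ∧ 2 * a * S₆ = b * S₃) := by
  have hH₃ : H₃ = 2 * a * H₆ / (w * b) := by
    rw [eq_div_iff (by positivity)]
    linarith
  have e : (a * S₆ - b * S₃ - (a * ((w ^ 2)⁻¹ * H₆) - b * (w⁻¹ * H₃))) * (4 * a * S₆ * H₆) =
      H₆ * (2 * a * S₆ - b * S₃) ^ 2 + b ^ 2 * (H₃ ^ 2 * S₆ - H₆ * S₃ ^ 2) := by
    rw [hH₃]
    field_simp
    ring
  have hp : 0 < 4 * a * S₆ * H₆ := by positivity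
  have h1 : 0 ≤ H₆ * (2 * a * S₆ - b * S₃) ^ 2 := by positivity
  have h2 : 0 ≤ b ^ 2 * (H₃ ^ 2 * S₆ - H₆ * S₃ ^ 2) := by
    have := sub_nonneg.2 hS
    positivity
  constructor
  · have := nonneg_of_mul_nonneg_left (e ▸ add_nonneg h1 h2) hp
    linarith
  · intro heq
    rw [heq, sub_self, zero_mul] at e
    have h3 : H₆ * (2 * a * S₆ - b * S₃) ^ 2 = 0 := by linarith
    have h4 : b ^ 2 * (H₃ ^ 2 * S₆ - H₆ * S₃ ^ 2) = 0 := by linarith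
    have h5 := (mul_eq_zero.1 h4).resolve_left (by positivity)
    have h6 := pow_eq_zero_iff two_ne_zero |>.1 ((mul_eq_zero.1 h3).resolve_left hH₆.ne')
    constructor <;> linarith

/-- Optimality of the triangular lattice for the classical (12,6) Lennard-Jones energy:
for any `a, b > 0`, the triangular lattice of co-volume
`V_{A₂} = (2aζ_{A₂}(12)/(bζ_{A₂}(6)))^{1/3}` is the unique global minimizer, up to rotation,
of `E_f` among all two-dimensional lattices. -/
theorem LJ_12_6_global_minimality
    (a b : ℝ) (ha : 0 < a) (hb : 0 < b) (VA2 : ℝ)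
    (hVA2 : VA2 = (2 * a * epsteinZeta triangularLattice 12 /
      (b * epsteinZeta triangularLattice 6)) ^ ((1 : ℝ) / 3)) :
    ∀ L : Set (EuclideanSpace ℝ (Fin 2)), IsLattice2 L →
      LJenergy a b 12 6 (Real.sqrt VA2 • triangularLattice) ≤ LJenergy a b 12 6 L ∧
      (LJenergy a b 12 6 L = LJenergy a b 12 6 (Real.sqrt VA2 • triangularLattice) ↔
        IsRotationOf L (Real.sqrt VA2 • triangularLattice)) := by
  obtain ⟨u₀, v₀, t, ht, hT, hu₀, hv₀, huv₀⟩ := exists_triangularLattice_basis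
  have hd₀ := det2_ne_zero_of_equilateral ht hu₀ hv₀ huv₀
  set H₃ := formZeta 3 1 1 1 with hH₃
  set H₆ := formZeta 6 1 1 1 with hH₆
  have hH₃0 : 0 < H₃ := lt_of_lt_of_le (by norm_num) (six_le_formZeta_hex (by norm_num))
  have hH₆0 : 0 < H₆ := lt_of_lt_of_le (by norm_num) (six_le_formZeta_hex (by norm_num))
  rw [hT, epsteinZeta_latticeSet_twelve hd₀, epsteinZeta_latticeSet_six hd₀, hu₀, hv₀, huv₀,
    formZeta_self 6 t, formZeta_self 3 t, ← hH₃, ← hH₆] at hVA2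
  have hV : 0 < VA2 := by
    rw [hVA2]
    positivity
  have hV3 : (VA2 * t) ^ 3 * (b * H₃) = 2 * a * H₆ := by
    rw [mul_pow, hVA2, ← Real.rpow_natCast, ← Real.rpow_mul (by positivity)]
    norm_num
    field_simp
  rw [hT, smul_latticeSet]
  have hnorm : ∀ x : EuclideanSpace ℝ (Fin 2), ‖x‖ ^ 2 = t → ‖√VA2 • x‖ ^ 2 = VA2 * t :=
    fun x hx => by
      rw [norm_smul, mul_pow, Real.norm_eq_abs, sq_abs, Real.sq_sqrt hV.le, hx]
  have hu := hnorm _ hu₀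
  have hv := hnorm _ hv₀
  have huv : ‖√VA2 • u₀ - √VA2 • v₀‖ ^ 2 = VA2 * t := by
    rw [← smul_sub]
    exact hnorm _ huv₀
  have hVt : 0 < VA2 * t := by positivity
  have hd := det2_ne_zero_of_equilateral hVt hu hv huv
  have hE : LJenergy a b 12 6 (latticeSet (√VA2 • u₀) (√VA2 • v₀)) =
      a * ((((VA2 * t) ^ 3) ^ 2)⁻¹ * H₆) - b * (((VA2 * t) ^ 3)⁻¹ * H₃) := by
    rw [LJenergy_latticeSet a b hd, hu, hv, huv, formZeta_self 6 (VA2 * t),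
      formZeta_self 3 (VA2 * t), ← pow_mul]
  intro L hL
  obtain ⟨u, v, hdL, rfl, hAB, hBC, hCAB⟩ := exists_reduced_basis hL
  have hA : 0 < ‖u‖ ^ 2 := by
    have : 0 < ‖u‖ := norm_pos_iff.2 fun h => hdL (by simp [h, det2])
    positivity
  obtain ⟨hS, hSeq⟩ := hex_mul_formZeta_sq_le hA hAB hBC hCAB
  obtain ⟨hmin, heq⟩ := LJ_lower_bound ha hb hH₆0 (formZeta_norm_sq_pos hdL (by norm_num))
    (by positivity) hV3 hS
  rw [hE, LJenergy_latticeSet a b hdL]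
  refine ⟨hmin, fun h => ?_, ?_⟩
  · obtain ⟨h1, h2⟩ := heq h
    obtain ⟨hB, hC⟩ := hSeq h1
    rw [hB, hC, formZeta_self 6 (‖u‖ ^ 2), formZeta_self 3 (‖u‖ ^ 2), ← hH₃, ← hH₆] at h2
    have hA3 : (‖u‖ ^ 2) ^ 3 = (VA2 * t) ^ 3 := by
      refine mul_right_cancel₀ (b := b * H₃) (by positivity) ?_
      rw [hV3]
      generalize ‖u‖ ^ 2 = A at h2 hA
      field_simp at h2
      linarith
    have hAt : ‖u‖ ^ 2 = VA2 * t := (pow_left_inj₀ hA.le hVt.le (by norm_num)).1 hA3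
    obtain ⟨O, hO1, hO2⟩ := exists_linearIsometryEquiv hd (hAt.trans hu.symm)
      ((hB.trans hAt).trans hv.symm) ((hC.trans hAt).trans huv.symm)
    exact ⟨O, by rw [image_latticeSet, hO1, hO2]⟩
  · rintro ⟨O, hO⟩
    rw [← hE, ← LJenergy_latticeSet a b hdL, hO, LJenergy_image_latticeSet a b O hd]
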